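/- Fix d ≥ 2. There exists δ₆ > 0 such that for all n large enough, P( B[n/2] ⊆ A_{⌊e^{b_n}⌋} ) ≥ 1 − exp(−n^{δ₆}), where A_k denotes the uIDLA aggregate with k particles started from {0}. -/

import Mathlib

open MeasureTheory Filter
open scoped ENNReal

noncomputable section

/-- The `k`-th binary digit of `x ∈ [0,1)` (after the binary point). -/
def bit (x : ℝ) (k : ℕ) : Bool := ⌊x * 2 ^ (k + 1)⌋ % 2 == 1

/-- From one uniform sample on `[0,1]`, extract countably many independent uniform
samples on `[0,1]`, using disjoint subsequences of binary digits. -/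
def uSlice (x : ℝ) (i : ℕ) : ℝ :=
  ∑' j : ℕ, if bit x (Nat.pair i j) then ((2 : ℝ) ^ (-(j : ℤ) - 1)) else 0

/-- The base probability space: Lebesgue measure restricted to `[0,1]`. -/
def μ0 : Measure ℝ := volume.restrict (Set.Icc 0 1)

/-- The vertex set of the lattice `ℤ^d`. -/
abbrev V (d : ℕ) := Fin d → ℤ

instance (d : ℕ) : MeasurableSpace (Finset (V d)) := ⊤

open Classical in
/-- `B[r]`: the Euclidean ball of radius `r` in `ℤ^d`, as a `Finset`. -/
def ball (d : ℕ) (r : ℝ) : Finset (V d) :=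
  (Finset.Icc (fun _ => -⌈r⌉) (fun _ => ⌈r⌉)).filter
    (fun y => Real.sqrt (∑ i, ((y i : ℝ)) ^ 2) ≤ r)

/-- `b_n`: the number of lattice points in the Euclidean ball of radius `n`. -/
def bn (d n : ℕ) : ℕ := (ball d n).card

/-- The `2d` unit vectors of `ℤ^d` (the possible steps of the simple random walk). -/
def unitVecs (d : ℕ) : Finset (V d) :=
  Finset.image
    (fun p : Fin d × Bool => fun j => if j = p.1 then (if p.2 then 1 else -1) else 0)
    Finset.univ

/-- Given `u` uniform on `[0,1]`, `pick S u` is a uniformly chosen element of `S`. -/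
def pick {d : ℕ} (S : Finset (V d)) (u : ℝ) : V d :=
  if h : S.Nonempty then
    (S.equivFin.symm ⟨(⌊u * S.card⌋).toNat % S.card,
      Nat.mod_lt _ (Finset.card_pos.mpr h)⟩).val
  else 0

/-- Position at time `t` of the simple random walk started at `x`, driven by the
random seed `ω`: the steps `pick (unitVecs d) (uSlice ω i)` are i.i.d. uniform on
the `2d` unit vectors when `ω` is uniform on `[0,1]`. -/
def walk {d : ℕ} (x : V d) (ω : ℝ) (t : ℕ) : V d :=
  x + ∑ i ∈ Finset.range t, pick (unitVecs d) (uSlice ω i)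

/-- `t_S`: the first time the walk started at `x` is outside `S`. -/
def exitT {d : ℕ} (S : Finset (V d)) (x : V d) (ω : ℝ) : ℕ :=
  sInf {t | walk x ω t ∉ S}

/-- The position `ξ(t_S)` at which the walk started at `x` first exits `S`. -/
def hitPt {d : ℕ} (S : Finset (V d)) (x : V d) (ω : ℝ) : V d :=
  walk x ω (exitT S x ω)

/-- `Add[ξ,S]`: add to `S` the exit point of a random walk started at `x`. -/
def addPt {d : ℕ} (S : Finset (V d)) (x : V d) (ω : ℝ) : Finset (V d) :=
  insert (hitPt S x ω) S

/-- `P_x(ξ(τ_A) = y)`: the probability that the walk started at `x` exits `A` at `y`. -/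
def hitProb {d : ℕ} (A : Finset (V d)) (x y : V d) : ℝ≥0∞ :=
  μ0 {ω | hitPt A x ω = y}

/-- The outer boundary `∂A`: vertices outside `A` with a neighbour in `A`. -/
def outb {d : ℕ} (A : Finset (V d)) : Finset (V d) :=
  (A.biUnion fun x => (unitVecs d).image (fun e => x + e)) \ A

/-- `DA_X(S)`: the IDLA aggregate obtained from `S` by launching one particle from each
point of the list `xs` in turn (driven by independent slices of the seed `ω`). -/
def daFrom {d : ℕ} : Finset (V d) → List (V d) → ℝ → Finset (V d)
  | S, [], _ => S
  | S, x :: xs, ω => daFrom (addPt S x (uSlice ω 0)) xs (uSlice ω 1)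

/-- The law of the IDLA aggregate `DA_X(S)`. -/
def daLaw {d : ℕ} (S : Finset (V d)) (xs : List (V d)) : Measure (Finset (V d)) :=
  μ0.map (fun ω => daFrom S xs ω)

/-- One uIDLA step: launch a particle from a uniformly chosen point of `S`. -/
def uStep {d : ℕ} (S : Finset (V d)) (ω : ℝ) : Finset (V d) :=
  addPt S (pick S (uSlice ω 0)) (uSlice ω 1)

/-- `A_k(S)`: the uIDLA aggregate obtained by adding `k` particles to `S`,
each started at a uniform point of the current aggregate. -/
def uAggFrom {d : ℕ} (S : Finset (V d)) (ω : ℝ) : ℕ → Finset (V d)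
  | 0 => S
  | k + 1 => uStep (uAggFrom S ω k) (uSlice ω k)

/-- The law of the uIDLA aggregate `A_k(S)`. -/
def uLaw {d : ℕ} (S : Finset (V d)) (k : ℕ) : Measure (Finset (V d)) :=
  μ0.map (fun ω => uAggFrom S ω k)

/-- One step of the subset uIDLA `A_·(E;m)`: at step `k`, perform a uIDLA step
with probability `|E|/(m+k)` and otherwise do nothing. -/
def subStep {d : ℕ} (m k : ℕ) (E : Finset (V d)) (ω : ℝ) : Finset (V d) :=
  if uSlice ω 0 * ((m : ℝ) + k) ≤ E.card then uStep E (uSlice ω 1) else E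

/-- The subset uIDLA `A_n(E;m)`. -/
def subAggFrom {d : ℕ} (E : Finset (V d)) (m : ℕ) (ω : ℝ) : ℕ → Finset (V d)
  | 0 => E
  | k + 1 => subStep m k (subAggFrom E m ω k) (uSlice ω k)

/-- The law of the subset uIDLA `A_n(E;m)`. -/
def subLaw {d : ℕ} (E : Finset (V d)) (m k : ℕ) : Measure (Finset (V d)) :=
  μ0.map (fun ω => subAggFrom E m ω k)

/-- Stochastic domination of random finite subsets of `ℤ^d`: `μ` dominates `ν` if
there is a coupling under which the sample of `ν` is a.s. contained in that of `μ`. -/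
def StochDom {d : ℕ} (μ ν : Measure (Finset (V d))) : Prop :=
  ∃ π : Measure (Finset (V d) × Finset (V d)), IsProbabilityMeasure π ∧
    π.map Prod.fst = μ ∧ π.map Prod.snd = ν ∧ π {p | p.2 ⊆ p.1} = 1

/-- A `Geometric(1/2)` sample (taking value `j ≥ 0` with probability `2^{-(j+1)}`)
produced from a uniform sample `u` on `[0,1]` by inverting the CDF. -/
def geom (u : ℝ) : ℕ := sInf {j : ℕ | u ≤ 1 - (2 : ℝ) ^ (-(j : ℤ) - 1)}

/-- The parent of vertex `j ≥ 1` in the uniform random recursive tree (vertex `0` is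
the root): uniform on `{0, …, j-1}` when the seed is uniform on `[0,1]`. -/
def parent (ω : ℝ) (j : ℕ) : ℕ := (⌊uSlice ω (Nat.pair 0 j) * j⌋).toNat % j

/-- The reaching time of vertex `j` in a uniform random recursive tree whose edges
carry i.i.d. `Geometric(1/2)` weights: the sum of the weights on the path from the
root to `j`. (The `min` is a.s. inoperative, since a.s. `parent ω (j+1) ≤ j`.) -/
def reach (ω : ℝ) : ℕ → ℕ
  | 0 => 0
  | j + 1 => reach ω (min (parent ω (j + 1)) j) + geom (uSlice ω (Nat.pair 1 (j + 1)))
termination_by j => j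
decreasing_by exact Nat.lt_succ_of_le (min_le_right _ _)

end

section Prob
open ProbabilityTheory

instance : IsProbabilityMeasure μ0 := ⟨by simp [μ0]⟩

lemma μ0_apply (s : Set ℝ) : μ0 s = volume (s ∩ Set.Ico 0 1) := by
  have : μ0 = volume.restrict (Set.Ico (0:ℝ) 1) :=
    Measure.restrict_congr_set Ico_ae_eq_Icc.symm
  rw [this, Measure.restrict_apply' measurableSet_Ico]

lemma measurable_bit (k : ℕ) : Measurable (fun x => bit x k) := by
  unfold bit
  have h : Measurable (fun z : ℤ => (z % 2 == 1)) := measurable_of_countable _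
  exact h.comp (Int.measurable_floor.comp (measurable_id.mul_const _))

lemma bit_zero_iff (x : ℝ) (h0 : 0 ≤ x) (h1 : x < 1) : bit x 0 = true ↔ 1 / 2 ≤ x := by
  have e : bit x 0 = (⌊x * 2⌋ % 2 == 1) := by simp [bit]
  rw [e]
  by_cases h : 1 / 2 ≤ x
  · have : ⌊x * 2⌋ = 1 := by
      rw [Int.floor_eq_iff]; push_cast; constructor <;> linarith
    simp [this]; linarith
  · have : ⌊x * 2⌋ = 0 := by
      rw [Int.floor_eq_iff]; push_cast; constructor <;> linarith
    simp [this]; linarith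

noncomputable def shiftT (x : ℝ) : ℝ := Int.fract (2 * x)

lemma measurable_shiftT : Measurable shiftT := by
  unfold shiftT
  exact (measurable_id.const_mul _).fract

lemma bit_succ (x : ℝ) (k : ℕ) : bit x (k + 1) = bit (shiftT x) k := by
  unfold bit shiftT
  have : Int.fract (2 * x) * 2 ^ (k + 1) = x * 2 ^ (k + 1 + 1) - ((⌊2 * x⌋ * 2 ^ (k + 1) : ℤ) : ℝ) := by
    rw [Int.fract]; push_cast; ring
  rw [this, Int.floor_sub_intCast]
  have h2 : (⌊x * 2 ^ (k + 1 + 1)⌋ - ⌊2 * x⌋ * 2 ^ (k + 1)) % 2 = ⌊x * 2 ^ (k + 1 + 1)⌋ % 2 := by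
    rw [pow_succ (2 : ℤ) k, ← mul_assoc]; omega
  rw [h2]

lemma μ0_shift (a : Bool) (E : Set ℝ) :
    μ0 ({x | bit x 0 = a} ∩ shiftT ⁻¹' E) = 2⁻¹ * μ0 E := by
  rw [μ0_apply, μ0_apply]
  set m : ℝ := if a then 1 else 0 with hm
  have key : {x | bit x 0 = a} ∩ shiftT ⁻¹' E ∩ Set.Ico 0 1
      = (fun x => 2 * x) ⁻¹' ((fun x => x - m) ⁻¹' (E ∩ Set.Ico 0 1)) := by
    ext x
    simp only [Set.mem_inter_iff, Set.mem_ofPred_eq, Set.mem_preimage, Set.mem_Ico]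
    constructor
    · rintro ⟨⟨hb, hE⟩, h0, h1⟩
      have hi := bit_zero_iff x h0 h1
      have : shiftT x = 2 * x - m ∧ (0 ≤ 2 * x - m ∧ 2 * x - m < 1) := by
        cases a
        · have hx : ¬ (1 / 2 ≤ x) := by rw [← hi, hb]; simp
          simp only [hm]
          have : 0 ≤ 2 * x - 0 ∧ 2 * x - 0 < 1 := by constructor <;> linarith
          refine ⟨?_, by simpa using this⟩
          simp [shiftT, Int.fract_eq_self]; constructor <;> linarith
        · have hx : (1 / 2 ≤ x) := by rw [← hi, hb]
          simp only [hm]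
          refine ⟨?_, by constructor <;> simp <;> linarith⟩
          rw [shiftT, Int.fract_eq_iff]
          refine ⟨by simp; linarith, by simp; linarith, 1, by simp⟩
      exact ⟨this.1 ▸ hE, this.2⟩
    · rintro ⟨hE, h0, h1⟩
      have hx : 0 ≤ x ∧ x < 1 ∧ bit x 0 = a := by
        cases a
        · simp only [hm] at h0 h1
          simp at h0 h1
          have hx1 : x < 1 := by linarith
          refine ⟨h0, hx1, ?_⟩
          rw [← Bool.not_eq_true, bit_zero_iff x h0 hx1]; linarith
        · simp only [hm] at h0 h1
          simp at h0 h1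
          have hx0 : 0 ≤ x := by linarith
          have hx1 : x < 1 := by linarith
          refine ⟨hx0, hx1, ?_⟩
          rw [bit_zero_iff x hx0 hx1]; linarith
      have : shiftT x = 2 * x - m := by
        rw [shiftT, Int.fract_eq_iff]
        refine ⟨h0, h1, if a then 1 else 0, ?_⟩
        cases a <;> simp [hm]
      exact ⟨⟨hx.2.2, this ▸ hE⟩, hx.1, hx.2.1⟩
  rw [key, Real.volume_preimage_mul_left (by norm_num), show (fun x : ℝ => x - m) = (fun x => x + -m) from funext fun x => sub_eq_add_neg x m,
    measure_preimage_add_right]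
  congr 1
  rw [abs_of_pos (by norm_num), ENNReal.ofReal_inv_of_pos (by norm_num)]
  simp

noncomputable def coin : Measure Bool :=
  (2⁻¹ : ℝ≥0∞) • Measure.dirac true + (2⁻¹ : ℝ≥0∞) • Measure.dirac false

open Classical in
lemma coin_apply (t : Set Bool) :
    coin t = (if true ∈ t then (2⁻¹ : ℝ≥0∞) else 0) + (if false ∈ t then (2⁻¹ : ℝ≥0∞) else 0) := by
  simp [coin, Set.indicator]

instance : IsProbabilityMeasure coin := ⟨by
  rw [coin_apply]; simp only [Set.mem_univ, if_true]; exact ENNReal.inv_two_add_inv_two⟩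

lemma μ0_shift' (t : Set Bool) (E : Set ℝ) (hE : MeasurableSet E) :
    μ0 ({x | bit x 0 ∈ t} ∩ shiftT ⁻¹' E) = coin t * μ0 E := by
  classical
  have e : {x | bit x 0 ∈ t} ∩ shiftT ⁻¹' E =
      (if true ∈ t then {x | bit x 0 = true} ∩ shiftT ⁻¹' E else ∅) ∪
      (if false ∈ t then {x | bit x 0 = false} ∩ shiftT ⁻¹' E else ∅) := by
    ext x
    rcases hb : bit x 0 with _ | _ <;> by_cases h1 : true ∈ t <;> by_cases h2 : false ∈ t <;>
      simp [h1, h2, hb]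
  have hm (a : Bool) : MeasurableSet ({x | bit x 0 = a} ∩ shiftT ⁻¹' E) :=
    ((measurable_bit 0) (measurableSet_singleton a)).inter (measurable_shiftT hE)
  rw [e, measure_union, coin_apply, add_mul]
  · congr 1 <;> split_ifs <;> simp [μ0_shift]
  · rw [Set.disjoint_left]
    intro x hx hx'
    split_ifs at hx hx' <;> simp_all
  · split_ifs
    · exact hm _
    · exact MeasurableSet.empty

lemma μ0_cyl (n : ℕ) : ∀ t : ℕ → Set Bool,
    μ0 {x | ∀ i < n, bit x i ∈ t i} = ∏ i ∈ Finset.range n, coin (t i) := by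
  induction n with
  | zero => intro t; simp
  | succ n ih =>
    intro t
    rw [Finset.prod_range_succ', ← ih (fun i => t (i + 1)), mul_comm, ← μ0_shift']
    · congr 1
      ext x
      simp only [Set.mem_inter_iff, Set.mem_ofPred_eq, Set.mem_preimage]
      constructor
      · intro h
        exact ⟨h 0 (by omega), fun i hi => by rw [← bit_succ]; exact h (i + 1) (by omega)⟩
      · rintro ⟨h0, h⟩ i hi
        rcases i with _ | i
        · exact h0
        · rw [bit_succ]; exact h i (by omega)
    · have : {x | ∀ i < n, bit x i ∈ t (i + 1)} = ⋂ i, ⋂ (_ : i < n), (fun x => bit x i) ⁻¹' t (i + 1) := by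
        ext; simp
      rw [this]
      exact MeasurableSet.iInter fun i => MeasurableSet.iInter fun _ =>
        measurable_bit i MeasurableSet.of_discrete

lemma measurable_bits : Measurable (fun x => bit x) := measurable_pi_iff.2 measurable_bit

lemma map_bits : μ0.map (fun x => bit x) = Measure.infinitePi (fun _ : ℕ => coin) := by
  classical
  apply Measure.eq_infinitePi
  intro s t ht
  rw [Measure.map_apply measurable_bits (MeasurableSet.pi s.countable_toSet fun i _ => ht i)]
  obtain ⟨n, hn⟩ : ∃ n, s ⊆ Finset.range n := ⟨s.sup id + 1, fun i hi => by
    simpa [Nat.lt_succ_iff] using Finset.le_sup (f := id) hi⟩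
  have := μ0_cyl n (fun i => if i ∈ s then t i else Set.univ)
  rw [← Finset.prod_subset hn (f := fun i => coin (if i ∈ s then t i else Set.univ))] at this
  · rw [Finset.prod_congr rfl (g := fun i => coin (t i))] at this
    · rw [← this]
      congr 1
      ext x
      simp only [Set.mem_preimage, Set.mem_pi, Finset.mem_coe, Set.mem_ofPred_eq]
      constructor
      · intro h i _
        split_ifs with hi
        · exact h i hi
        · trivial
      · intro h i hi
        have := h i (by simpa using hn hi)
        simpa [hi] using this
    · intro i hi; simp [hi]
  · intro i _ hi; rw [if_neg hi]; exact measure_univ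

noncomputable def binF (b : ℕ → Bool) : ℝ := ∑' j : ℕ, if b j then ((2 : ℝ) ^ (-(j : ℤ) - 1)) else 0

lemma zpow_aux (j : ℕ) : ((2 : ℝ) ^ (-(j : ℤ) - 1)) = (1 / 2) / 2 / 1 * 2 * (1 / 2) ^ j := by
  rw [sub_eq_add_neg, zpow_add₀ (by norm_num), zpow_neg, zpow_natCast, one_div, inv_pow]
  norm_num; ring

lemma binF_summable (b : ℕ → Bool) :
    Summable (fun j : ℕ => if b j then ((2 : ℝ) ^ (-(j : ℤ) - 1)) else 0) := by
  refine Summable.of_nonneg_of_le (fun j => ?_) (fun j => ?_)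
    ((summable_geometric_of_lt_one (r := (1 / 2 : ℝ)) (by norm_num) (by norm_num)))
  · split_ifs <;> positivity
  · have : (0 : ℝ) < (1 / 2) ^ j := by positivity
    rw [zpow_aux]
    split_ifs <;> linarith

lemma measurable_binF : Measurable binF := by
  unfold binF
  refine Measurable.tsum (fun j => ?_) 
  have h : Measurable (fun c : Bool => if c then ((2 : ℝ) ^ (-(j : ℤ) - 1)) else 0) :=
    measurable_of_countable _
  exact h.comp (measurable_pi_apply j)

lemma binF_partial (x : ℝ) (h0 : 0 ≤ x) (h1 : x < 1) (n : ℕ) :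
    ∑ j ∈ Finset.range n, (if bit x j then ((2 : ℝ) ^ (-(j : ℤ) - 1)) else 0) = ⌊x * 2 ^ n⌋ / 2 ^ n := by
  induction n with
  | zero =>
    have : ⌊x⌋ = 0 := by rw [Int.floor_eq_iff]; simp [h0, h1]
    simp [this]
  | succ n ih =>
    rw [Finset.sum_range_succ, ih]
    set z := ⌊x * 2 ^ (n + 1)⌋ with hz
    have hfl : ⌊x * 2 ^ n⌋ = z / 2 := by
      rw [hz, Int.floor_eq_iff]
      have a1 := Int.floor_le (x * 2 ^ (n + 1))
      have a2 := Int.lt_floor_add_one (x * 2 ^ (n + 1))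
      rw [← hz] at a1 a2 ⊢
      have b1 : 2 * (z / 2) ≤ z := by omega
      have b2 : z + 1 ≤ 2 * (z / 2) + 2 := by omega
      have b1' : (2 : ℝ) * ((z / 2 : ℤ) : ℝ) ≤ z := by exact_mod_cast b1
      have b2' : (z : ℝ) + 1 ≤ 2 * ((z / 2 : ℤ) : ℝ) + 2 := by exact_mod_cast b2
      rw [pow_succ] at a1 a2
      constructor <;> linarith
    have hbit : bit x n = (z % 2 == 1) := rfl
    rw [hfl, hbit]
    have hzz : (z : ℝ) = 2 * ((z / 2 : ℤ) : ℝ) + ((z % 2 : ℤ) : ℝ) := by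
      exact_mod_cast (Int.mul_ediv_add_emod z 2).symm
    have hp : (2 : ℝ) ^ (-(n : ℤ) - 1) = 1 / 2 ^ (n + 1) := by
      rw [zpow_aux, pow_succ, one_div_pow]; field_simp
    rw [hp, hzz]
    rcases Int.emod_two_eq_zero_or_one z with h | h <;> rw [h] <;> simp <;> field_simp <;> ring

lemma binF_bit (x : ℝ) (h0 : 0 ≤ x) (h1 : x < 1) : binF (bit x) = x := by
  have ht := (binF_summable (bit x)).hasSum.tendsto_sum_nat
  refine tendsto_nhds_unique ht ?_
  simp_rw [binF_partial x h0 h1]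
  have hlim : Tendsto (fun n : ℕ => x - (1 / 2 : ℝ) ^ n) atTop (nhds (x - 0)) :=
    tendsto_const_nhds.sub (tendsto_pow_atTop_nhds_zero_of_lt_one (by norm_num) (by norm_num))
  rw [sub_zero] at hlim
  refine tendsto_of_tendsto_of_tendsto_of_le_of_le hlim tendsto_const_nhds (fun n => ?_) (fun n => ?_)
  · have a2 := Int.lt_floor_add_one (x * 2 ^ n)
    have : (0 : ℝ) < 2 ^ n := by positivity
    simp only [one_div, inv_pow]
    rw [le_div_iff₀ this, sub_mul, inv_mul_cancel₀ this.ne']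
    linarith
  · have a1 := Int.floor_le (x * 2 ^ n)
    exact (div_le_iff₀ (by positivity)).2 a1

lemma map_binF : (Measure.infinitePi (fun _ : ℕ => coin)).map binF = μ0 := by
  rw [← map_bits, Measure.map_map measurable_binF measurable_bits]
  conv_rhs => rw [← Measure.map_id (μ := μ0)]
  apply Measure.map_congr
  have : ∀ᵐ x ∂μ0, x ∈ Set.Ico (0:ℝ) 1 := by
    rw [ae_iff, μ0_apply]
    have : {a : ℝ | a ∉ Set.Ico (0:ℝ) 1} ∩ Set.Ico 0 1 = ∅ := by ext; simp
    rw [this]; simp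
  filter_upwards [this] with x hx
  exact binF_bit x hx.1 hx.2

lemma uSlice_eq (x : ℝ) (i : ℕ) : uSlice x i = binF (fun j => bit x (Nat.pair i j)) := rfl

lemma measurable_uSlice (i : ℕ) : Measurable (fun x => uSlice x i) := by
  simp_rw [uSlice_eq]
  exact measurable_binF.comp (measurable_pi_iff.2 fun j => measurable_bit _)

lemma map_uSlices : μ0.map (fun x => uSlice x) = Measure.infinitePi (fun _ : ℕ => μ0) := by
  have h1 : (fun x => uSlice x) = (fun (b : ℕ → ℕ → Bool) i => binF (b i)) ∘
      (MeasurableEquiv.curry ℕ ℕ Bool) ∘ (fun (b : ℕ → Bool) (p : ℕ × ℕ) => b (Nat.pair p.1 p.2)) ∘ (fun x => bit x) := by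
    rfl
  have m1 : Measurable (fun (b : ℕ → ℕ → Bool) i => binF (b i)) :=
    measurable_pi_iff.2 fun i => measurable_binF.comp (measurable_pi_apply i)
  have m3 : Measurable (fun (b : ℕ → Bool) (p : ℕ × ℕ) => b (Nat.pair p.1 p.2)) :=
    measurable_pi_iff.2 fun p => measurable_pi_apply _
  rw [h1, ← Measure.map_map m1 ((MeasurableEquiv.measurable _).comp (m3.comp measurable_bits)),
    ← Measure.map_map (MeasurableEquiv.measurable _) (m3.comp measurable_bits),
    ← Measure.map_map m3 measurable_bits, map_bits]
  have h3 := Measure.map_infinitePi_infinitePi_of_inj (P := fun _ : ℕ => coin) (f := fun p : ℕ × ℕ => Nat.pair p.1 p.2)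
    (Nat.pairEquiv.injective)
  rw [h3, Measure.infinitePi_map_curry (fun _ _ => coin)]
  rw [Measure.infinitePi_map_pi (μ := fun _ => Measure.infinitePi (fun _ : ℕ => coin)) (f := fun _ => binF) (fun _ => measurable_binF)]
  simp_rw [map_binF]

lemma map_uSlice (i : ℕ) : μ0.map (fun x => uSlice x i) = μ0 := by
  have : (fun x => uSlice x i) = (fun u : ℕ → ℝ => u i) ∘ (fun x => uSlice x) := rfl
  rw [this, ← Measure.map_map (measurable_pi_apply i) (measurable_pi_iff.2 measurable_uSlice),
    map_uSlices, Measure.infinitePi_map_eval]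

lemma iIndep_uSlice : iIndepFun (fun i x => uSlice x i) μ0 := by
  rw [iIndepFun_iff_map_fun_eq_infinitePi_map measurable_uSlice]
  simp_rw [map_uSlice]
  exact map_uSlices

lemma measurable_pick {d : ℕ} (S : Finset (V d)) : Measurable (pick S) := by
  have h : ∃ g : ℤ → V d, pick S = g ∘ (fun u : ℝ => ⌊u * S.card⌋) := by
    by_cases h : S.Nonempty
    · refine ⟨fun z => (S.equivFin.symm ⟨z.toNat % S.card,
        Nat.mod_lt _ (Finset.card_pos.mpr h)⟩).val, ?_⟩
      funext u
      simp [pick, h]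
    · refine ⟨fun _ => 0, ?_⟩
      funext u
      simp [pick, h]
  obtain ⟨g, hg⟩ := h
  rw [hg]
  exact (measurable_of_countable g).comp (Int.measurable_floor.comp (measurable_id.mul_const _))

lemma μ0_pick {d : ℕ} (S : Finset (V d)) (x : V d) (hx : x ∈ S) :
    (S.card : ℝ≥0∞)⁻¹ ≤ μ0 {u | pick S u = x} := by
  have hne : S.Nonempty := ⟨x, hx⟩
  have hN : (0 : ℝ) < S.card := by exact_mod_cast Finset.card_pos.mpr hne
  set i := S.equivFin ⟨x, hx⟩ with hi
  have hiN : ((i : ℕ) : ℝ) + 1 ≤ S.card := by exact_mod_cast i.2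
  have hsub : Set.Ico ((i : ℝ) / S.card) (((i : ℝ) + 1) / S.card) ⊆
      {u | pick S u = x} ∩ Set.Ico 0 1 := by
    rintro u ⟨h1, h2⟩
    have h1' := (div_le_iff₀ hN).1 h1
    have h2' := (lt_div_iff₀ hN).1 h2
    refine ⟨?_, ?_, ?_⟩
    · have hf : ⌊u * S.card⌋ = ((i : ℕ) : ℤ) := by
        rw [Int.floor_eq_iff]; push_cast; exact ⟨h1', h2'⟩
      simp only [Set.mem_ofPred_eq, pick, hne, dif_pos, hf, Int.toNat_natCast]
      have : (⟨(i : ℕ) % S.card, Nat.mod_lt _ (Finset.card_pos.mpr hne)⟩ : Fin S.card) = i := by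
        ext; simp [Nat.mod_eq_of_lt i.2]
      rw [this, hi]; simp
    · exact le_trans (by positivity) h1
    · refine lt_of_lt_of_le h2 ?_
      rw [div_le_one hN]; exact hiN
  rw [μ0_apply]
  refine le_trans (le_of_eq ?_) (measure_mono hsub)
  rw [Real.volume_Ico, ← sub_div, add_sub_cancel_left, one_div, ENNReal.ofReal_inv_of_pos hN,
    ENNReal.ofReal_natCast]

lemma measurable_walk {d : ℕ} (x : V d) (t : ℕ) : Measurable (fun ω => walk x ω t) := by
  unfold walk
  refine measurable_const.add (Finset.measurable_sum _ fun i _ => ?_)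
  exact (measurable_pick _).comp (measurable_uSlice i)

lemma measurable_exitT {d : ℕ} (S : Finset (V d)) (x : V d) : Measurable (exitT S x) := by
  classical
  have hm (t : ℕ) : MeasurableSet {ω | walk x ω t ∉ S} :=
    measurable_walk x t (MeasurableSet.of_discrete (s := {v | v ∉ S}))
  refine measurable_to_countable' fun t => ?_
  have hle (t : ℕ) : MeasurableSet {ω | ∃ s ≤ t, walk x ω s ∉ S} := by
    have : {ω | ∃ s ≤ t, walk x ω s ∉ S} = ⋃ s, ⋃ (_ : s ≤ t), {ω | walk x ω s ∉ S} := by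
      ext; simp
    rw [this]
    exact MeasurableSet.iUnion fun s => MeasurableSet.iUnion fun _ => hm s
  have hex : MeasurableSet {ω | ∃ s, walk x ω s ∉ S} := by
    have : {ω | ∃ s, walk x ω s ∉ S} = ⋃ s, {ω | walk x ω s ∉ S} := by ext; simp
    rw [this]
    exact MeasurableSet.iUnion hm
  have key : exitT S x ⁻¹' {t} =
      ({ω | walk x ω t ∉ S} ∩ ⋂ s, ⋂ (_ : s < t), {ω | walk x ω s ∉ S}ᶜ) ∪
      ({ω | ∃ s, walk x ω s ∉ S}ᶜ ∩ {_ω | t = 0}) := by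
    ext ω
    simp only [Set.mem_preimage, Set.mem_singleton_iff, Set.mem_union, Set.mem_inter_iff,
      Set.mem_iInter, Set.mem_compl_iff, Set.mem_ofPred_eq]
    by_cases h : ∃ s, walk x ω s ∉ S
    · have hne : {t | walk x ω t ∉ S}.Nonempty := h
      constructor
      · intro he
        left
        rw [← he]
        exact ⟨Nat.sInf_mem hne, fun s hs => Nat.notMem_of_lt_sInf hs⟩
      · rintro (⟨h1, h2⟩ | ⟨h1, _⟩)
        · refine le_antisymm (Nat.sInf_le h1) ?_
          by_contra hlt
          exact h2 _ (not_le.1 hlt) (Nat.sInf_mem hne)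
        · exact absurd h h1
    · have he : {t | walk x ω t ∉ S} = ∅ := by
        ext s; simp only [Set.mem_ofPred_eq, Set.mem_empty_iff_false, iff_false]
        intro hs; exact h ⟨s, hs⟩
      have : exitT S x ω = 0 := by rw [exitT, he]; simp
      rw [this]
      constructor
      · intro h0; right; exact ⟨h, h0.symm⟩
      · rintro (⟨h1, _⟩ | ⟨_, h0⟩)
        · exact absurd ⟨t, h1⟩ h
        · exact h0.symm
  rw [key]
  exact ((hm t).inter (MeasurableSet.iInter fun s => MeasurableSet.iInter fun _ => (hm s).compl)).union
    (hex.compl.inter (MeasurableSet.const _))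

lemma measurable_hitPt {d : ℕ} (S : Finset (V d)) (x : V d) : Measurable (hitPt S x) := by
  have h : Measurable (fun p : ℝ × ℕ => walk x p.1 p.2) :=
    measurable_from_prod_countable_left (fun t => measurable_walk x t)
  have h2 : Measurable (fun ω : ℝ => (ω, exitT S x ω)) :=
    Measurable.prodMk measurable_id (measurable_exitT S x)
  have h3 : hitPt S x = (fun p : ℝ × ℕ => walk x p.1 p.2) ∘ (fun ω : ℝ => (ω, exitT S x ω)) := by
    funext ω; simp only [hitPt, Function.comp]
  rw [h3]
  exact Measurable.comp h h2

instance (d : ℕ) : MeasurableSingletonClass (Finset (V d)) := ⟨fun _ => trivial⟩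

lemma measurable_uStep {d : ℕ} (S : Finset (V d)) : Measurable (uStep S) := by
  have h1 : Measurable (fun p : V d × ℝ => hitPt S p.1 p.2) :=
    measurable_from_prod_countable_right (fun x => measurable_hitPt S x)
  have h2 : Measurable (fun v : V d => insert v S) := measurable_of_countable _
  exact h2.comp (h1.comp (((measurable_pick S).comp (measurable_uSlice 0)).prodMk (measurable_uSlice 1)))

lemma measurable_uStep2 {d : ℕ} : Measurable (fun p : Finset (V d) × ℝ => uStep p.1 p.2) :=
  measurable_from_prod_countable_right measurable_uStep

/-- If the walk launched at `x` leaves at its first step, we add `x + e`. -/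
lemma uStep_success {d : ℕ} (S : Finset (V d)) (x e : V d) (hx : x ∈ S) (hxe : x + e ∉ S) (u : ℝ)
    (h1 : pick S (uSlice u 0) = x) (h2 : pick (unitVecs d) (uSlice (uSlice u 1) 0) = e) :
    uStep S u = insert (x + e) S := by
  have w0 : walk x (uSlice u 1) 0 = x := by simp [walk]
  have w1 : walk x (uSlice u 1) 1 = x + e := by simp [walk, h2]
  have ht : exitT S x (uSlice u 1) = 1 := by
    unfold exitT
    refine le_antisymm (Nat.sInf_le (by simpa [w1] using hxe)) ?_
    rw [Nat.one_le_iff_ne_zero]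
    intro h0
    rcases Nat.sInf_eq_zero.1 h0 with h | h
    · simp [w0, hx] at h
    · have : (1 : ℕ) ∈ {t | walk x (uSlice u 1) t ∉ S} := by simpa [w1] using hxe
      rw [h] at this; exact this
  rw [uStep, h1, addPt, hitPt, ht, w1]

def succEvent {d : ℕ} (S : Finset (V d)) (x e : V d) : Set ℝ :=
  {u | pick S (uSlice u 0) = x} ∩ {u | pick (unitVecs d) (uSlice (uSlice u 1) 0) = e}

lemma measurable_succEvent {d : ℕ} (S : Finset (V d)) (x e : V d) :
    MeasurableSet (succEvent S x e) := by
  refine MeasurableSet.inter ?_ ?_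
  · exact ((measurable_pick S).comp (measurable_uSlice 0)) (measurableSet_singleton x)
  · exact ((measurable_pick _).comp ((measurable_uSlice 0).comp (measurable_uSlice 1)))
      (measurableSet_singleton e)

lemma card_unitVecs_le (d : ℕ) : (unitVecs d).card ≤ 2 * d := by
  refine Finset.card_image_le.trans ?_
  simp [mul_comm]

lemma μ0_succEvent {d : ℕ} (S : Finset (V d)) (x e : V d) (hx : x ∈ S) (he : e ∈ unitVecs d) :
    (S.card : ℝ≥0∞)⁻¹ * ((2 * d : ℕ) : ℝ≥0∞)⁻¹ ≤ μ0 (succEvent S x e) := by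
  have hind : IndepFun (fun u => uSlice u 0) (fun u => uSlice u 1) μ0 :=
    iIndep_uSlice.indepFun (by norm_num)
  have m1 : MeasurableSet {u | pick S u = x} := measurable_pick S (measurableSet_singleton x)
  have m2' : MeasurableSet {u | pick (unitVecs d) u = e} :=
    measurable_pick _ (measurableSet_singleton e)
  have m2 : MeasurableSet {u | pick (unitVecs d) (uSlice u 0) = e} :=
    measurable_uSlice 0 m2'
  have := hind.measure_inter_preimage_eq_mul {u | pick S u = x}
    {u | pick (unitVecs d) (uSlice u 0) = e} m1 m2
  have e1 : succEvent S x e = (fun u => uSlice u 0) ⁻¹' {u | pick S u = x} ∩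
    (fun u => uSlice u 1) ⁻¹' {u | pick (unitVecs d) (uSlice u 0) = e} := rfl
  rw [e1, this, ← Measure.map_apply (measurable_uSlice 0) m1, map_uSlice,
    ← Measure.map_apply (measurable_uSlice 1) m2, map_uSlice]
  have e2 : {u | pick (unitVecs d) (uSlice u 0) = e} =
    (fun u => uSlice u 0) ⁻¹' {u | pick (unitVecs d) u = e} := rfl
  rw [e2, ← Measure.map_apply (measurable_uSlice 0) m2', map_uSlice]
  refine mul_le_mul' (μ0_pick S x hx) (le_trans ?_ (μ0_pick _ e he))
  rw [ENNReal.inv_le_inv]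
  exact_mod_cast card_unitVecs_le d

/-- `ℓ¹` distance. -/
def dist1 {d : ℕ} (x y : V d) : ℕ := ∑ i, (x i - y i).natAbs

lemma dist1_eq_zero {d : ℕ} (x y : V d) : dist1 x y = 0 ↔ x = y := by
  simp [dist1, Finset.sum_eq_zero_iff, sub_eq_zero, funext_iff]

lemma exists_closer {d : ℕ} (x y : V d) (h : x ≠ y) :
    ∃ e ∈ unitVecs d, dist1 (x + e) y + 1 = dist1 x y := by
  obtain ⟨i, hi⟩ := Function.ne_iff.1 h
  refine ⟨fun j => if j = i then (if decide (x i < y i) then 1 else -1) else 0, ?_, ?_⟩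
  · exact Finset.mem_image.2 ⟨(i, decide (x i < y i)), Finset.mem_univ _, rfl⟩
  · unfold dist1
    rw [← Finset.add_sum_erase _ _ (Finset.mem_univ i),
      ← Finset.add_sum_erase _ (fun j => (x j - y j).natAbs) (Finset.mem_univ i)]
    have : ∑ j ∈ Finset.univ.erase i, ((x + fun j => if j = i then
        (if decide (x i < y i) then (1 : ℤ) else -1) else 0) j - y j).natAbs =
        ∑ j ∈ Finset.univ.erase i, (x j - y j).natAbs := by
      refine Finset.sum_congr rfl fun j hj => ?_
      simp [Finset.ne_of_mem_erase hj]
    rw [this]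
    simp only [Pi.add_apply, if_true]
    by_cases hlt : x i < y i
    · simp [hlt]; omega
    · simp [hlt]; omega

noncomputable def gg (m : ℕ) : ℝ≥0∞ := if m = 0 then 0 else 2 ^ m

noncomputable def psi {d : ℕ} (y : V d) (S : Finset (V d)) : ℝ≥0∞ := ⨅ x ∈ S, gg (dist1 x y)

lemma psi_anti {d : ℕ} (y : V d) {S T : Finset (V d)} (h : S ⊆ T) : psi y T ≤ psi y S :=
  biInf_mono fun _ hx => h hx

lemma gg_mono {a b : ℕ} (h : a ≤ b) : gg a ≤ gg b := by
  unfold gg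
  split_ifs with h1 h2
  · exact le_rfl
  · exact zero_le
  · omega
  · exact pow_le_pow_right₀ (by norm_num) h

lemma gg_succ (a : ℕ) : gg a ≤ 2⁻¹ * gg (a + 1) := by
  unfold gg
  rw [if_neg (Nat.succ_ne_zero a)]
  split_ifs with h1
  · exact zero_le
  · rw [pow_succ, mul_comm, mul_assoc, ENNReal.mul_inv_cancel (by norm_num) (by norm_num), mul_one]

lemma gg_ne_top (a : ℕ) : gg a ≠ ⊤ := by
  unfold gg; split_ifs <;> simp

lemma psi_one_le {d : ℕ} (y : V d) (S : Finset (V d)) (hy : y ∉ S) : 1 ≤ psi y S := by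
  refine le_iInf₂ fun x hx => ?_
  have : dist1 x y ≠ 0 := by
    rw [Ne, dist1_eq_zero]; rintro rfl; exact hy hx
  rw [gg, if_neg this]
  exact one_le_pow₀ (by norm_num)

lemma subset_uStep {d : ℕ} (S : Finset (V d)) (u : ℝ) : S ⊆ uStep S u := Finset.subset_insert _ _

/-- One-step contraction. -/
lemma one_step {d : ℕ} (y : V d) (S : Finset (V d)) (hS : S.Nonempty) (m : ℕ) (hm : S.card ≤ m) :
    ∫⁻ u, psi y (uStep S u) ∂μ0 ≤
      (1 - 2⁻¹ * ((m : ℝ≥0∞)⁻¹ * ((2 * d : ℕ) : ℝ≥0∞)⁻¹)) * psi y S := by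
  by_cases hy : y ∈ S
  · have : psi y S = 0 := by
      refine le_antisymm ((iInf₂_le y hy).trans ?_) zero_le
      simp [gg, (dist1_eq_zero y y).2 rfl]
    rw [this, mul_zero]
    have h0 : ∀ u, psi y (uStep S u) = 0 := fun u =>
      le_antisymm ((psi_anti y (subset_uStep S u)).trans this.le) zero_le
    simp [h0]
  · obtain ⟨x, hx, hmin⟩ := Finset.exists_min_image S (fun x => dist1 x y) hS
    have hpsi : psi y S = gg (dist1 x y) :=
      le_antisymm (iInf₂_le x hx) (le_iInf₂ fun z hz => gg_mono (hmin z hz))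
    obtain ⟨e, he, hd⟩ := exists_closer x y (by rintro rfl; exact hy hx)
    have hxe : x + e ∉ S := fun h => by have := hmin _ h; omega
    set G := succEvent S x e
    have hG : MeasurableSet G := measurable_succEvent S x e
    have hfin : psi y S ≠ ⊤ := by rw [hpsi]; exact gg_ne_top _
    have hGp := μ0_succEvent S x e hx he
    have hb1 : ∀ u ∈ G, psi y (uStep S u) ≤ 2⁻¹ * psi y S := by
      rintro u ⟨h1, h2⟩
      rw [uStep_success S x e hx hxe u h1 h2, hpsi, ← hd]
      exact (iInf₂_le (x + e) (Finset.mem_insert_self _ _)).trans (gg_succ _)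
    rw [← lintegral_add_compl _ hG]
    have i1 : ∫⁻ u in G, psi y (uStep S u) ∂μ0 ≤ 2⁻¹ * psi y S * μ0 G := by
      rw [← setLIntegral_const]
      exact setLIntegral_mono' hG hb1
    have i2 : ∫⁻ u in Gᶜ, psi y (uStep S u) ∂μ0 ≤ psi y S * μ0 Gᶜ := by
      rw [← setLIntegral_const]
      exact setLIntegral_mono' hG.compl fun u _ => psi_anti y (subset_uStep S u)
    refine (add_le_add i1 i2).trans ?_
    set p := μ0 G
    have hp1 : p ≤ 1 := prob_le_one
    have hc : μ0 Gᶜ = 1 - p := prob_compl_eq_one_sub hG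
    have hq : (m : ℝ≥0∞)⁻¹ * ((2 * d : ℕ) : ℝ≥0∞)⁻¹ ≤ p := by
      refine le_trans (mul_le_mul' ?_ le_rfl) hGp
      rw [ENNReal.inv_le_inv]; exact_mod_cast hm
    rw [hc]
    calc 2⁻¹ * psi y S * p + psi y S * (1 - p) = (2⁻¹ * p + (1 - p)) * psi y S := by ring
      _ ≤ (1 - 2⁻¹ * p) * psi y S := by
        refine mul_le_mul' ?_ le_rfl
        have hpt : p ≠ ⊤ := ne_top_of_le_ne_top ENNReal.one_ne_top hp1
        have hht : 2⁻¹ * p ≠ ⊤ := ENNReal.mul_ne_top (by simp) hpt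
        refine ENNReal.le_sub_of_add_le_right hht ?_
        have : 2⁻¹ * p + (1 - p) + 2⁻¹ * p = (2⁻¹ + 2⁻¹) * p + (1 - p) := by ring
        rw [this, ENNReal.inv_two_add_inv_two, one_mul, add_tsub_cancel_of_le hp1]
      _ ≤ _ := by
        refine mul_le_mul' (tsub_le_tsub_left (mul_le_mul' le_rfl hq) 1) le_rfl

noncomputable def aggS {d : ℕ} (S : Finset (V d)) (u : ℕ → ℝ) : ℕ → Finset (V d)
  | 0 => S
  | k + 1 => uStep (aggS S u k) (u k)

lemma uAgg_eq {d : ℕ} (S : Finset (V d)) (ω : ℝ) (k : ℕ) :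
    uAggFrom S ω k = aggS S (uSlice ω) k := by
  induction k with
  | zero => rfl
  | succ k ih => rw [uAggFrom, aggS, ih]

lemma aggS_congr {d : ℕ} (S : Finset (V d)) (u v : ℕ → ℝ) (k : ℕ) (h : ∀ i < k, u i = v i) :
    aggS S u k = aggS S v k := by
  induction k with
  | zero => rfl
  | succ k ih => rw [aggS, aggS, ih (fun i hi => h i (by omega)), h k (by omega)]

lemma measurable_aggS {d : ℕ} (S : Finset (V d)) (k : ℕ) :
    Measurable (fun u : ℕ → ℝ => aggS S u k) := by
  induction k with
  | zero => exact measurable_const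
  | succ k ih =>
    have h : Measurable (fun u : ℕ → ℝ => (aggS S u k, u k)) :=
      Measurable.prodMk ih (measurable_pi_apply k)
    have h3 : (fun u : ℕ → ℝ => aggS S u (k + 1)) =
        (fun p : Finset (V d) × ℝ => uStep p.1 p.2) ∘ (fun u : ℕ → ℝ => (aggS S u k, u k)) := by
      funext u; simp only [aggS, Function.comp]
    rw [h3]
    exact Measurable.comp measurable_uStep2 h

lemma measurable_uAgg {d : ℕ} (S : Finset (V d)) (k : ℕ) :
    Measurable (fun ω => uAggFrom S ω k) := by
  have h3 : (fun ω => uAggFrom S ω k) =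
      (fun u : ℕ → ℝ => aggS S u k) ∘ (fun ω => uSlice ω) := by
    funext ω; simp only [uAgg_eq, Function.comp]
  rw [h3]
  exact Measurable.comp (measurable_aggS S k) (measurable_pi_iff.2 measurable_uSlice)

lemma indep_uAgg {d : ℕ} (S : Finset (V d)) (k : ℕ) :
    IndepFun (fun ω => uAggFrom S ω k) (fun ω => uSlice ω k) μ0 := by
  have h := iIndep_uSlice.indepFun_finset (Finset.range k) {k} (by simp) measurable_uSlice
  have m1 : Measurable (fun r : (Finset.range k) → ℝ =>
      aggS S (fun i => if hi : i ∈ Finset.range k then r ⟨i, hi⟩ else 0) k) := by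
    refine Measurable.comp (measurable_aggS S k) (measurable_pi_iff.2 fun i => ?_)
    by_cases hi : i ∈ Finset.range k
    · simp only [hi, dif_pos]; exact measurable_pi_apply _
    · simp only [hi, dif_neg, not_false_eq_true]; exact measurable_const
  have m2 : Measurable (fun r : ({k} : Finset ℕ) → ℝ => r ⟨k, Finset.mem_singleton_self k⟩) :=
    measurable_pi_apply _
  have h2 := h.comp m1 m2
  convert h2 using 1
  · funext ω
    simp only [Function.comp]
    rw [uAgg_eq]
    refine aggS_congr S _ _ k fun i hi => ?_
    simp [hi]
  · funext ω
    simp only [Function.comp]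

lemma uAgg_card {d : ℕ} (ω : ℝ) (k : ℕ) : (uAggFrom ({0} : Finset (V d)) ω k).card ≤ k + 1 := by
  induction k with
  | zero => simp [uAggFrom]
  | succ k ih =>
    rw [uAggFrom, uStep, addPt]
    exact (Finset.card_insert_le _ _).trans (by omega)

lemma uAgg_zero_mem {d : ℕ} (ω : ℝ) (k : ℕ) : (0 : V d) ∈ uAggFrom ({0} : Finset (V d)) ω k := by
  induction k with
  | zero => simp [uAggFrom]
  | succ k ih => exact subset_uStep _ _ ih

lemma expect_step {d : ℕ} (y : V d) (k : ℕ) :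
    ∫⁻ ω, psi y (uAggFrom ({0} : Finset (V d)) ω (k + 1)) ∂μ0 ≤
      (1 - 2⁻¹ * (((k + 1 : ℕ) : ℝ≥0∞)⁻¹ * ((2 * d : ℕ) : ℝ≥0∞)⁻¹)) *
        ∫⁻ ω, psi y (uAggFrom ({0} : Finset (V d)) ω k) ∂μ0 := by
  have mp : Measurable (psi y) := measurable_of_countable _
  have mA := measurable_uAgg ({0} : Finset (V d)) k
  have mU := measurable_uSlice k
  have hmap := (indepFun_iff_map_prod_eq_prod_map_map mA.aemeasurable mU.aemeasurable).1
    (indep_uAgg ({0} : Finset (V d)) k)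
  have mf : Measurable (fun p : Finset (V d) × ℝ => psi y (uStep p.1 p.2)) :=
    Measurable.comp (g := psi y) mp measurable_uStep2
  have e1 : ∫⁻ ω, psi y (uAggFrom ({0} : Finset (V d)) ω (k + 1)) ∂μ0 =
      ∫⁻ p, psi y (uStep p.1 p.2) ∂(μ0.map (fun ω => (uAggFrom ({0} : Finset (V d)) ω k, uSlice ω k))) := by
    rw [lintegral_map mf (mA.prodMk mU)]
    rfl
  have : IsProbabilityMeasure (μ0.map (fun ω => uAggFrom ({0} : Finset (V d)) ω k)) :=
    Measure.isProbabilityMeasure_map mA.aemeasurable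
  rw [e1, hmap, map_uSlice, lintegral_prod _ mf.aemeasurable]
  rw [lintegral_map (Measurable.lintegral_prod_right' mf) mA]
  have mpA : Measurable (fun ω => psi y (uAggFrom ({0} : Finset (V d)) ω k)) :=
    Measurable.comp (g := psi y) mp mA
  rw [← lintegral_const_mul _ mpA]
  refine lintegral_mono fun ω => ?_
  exact one_step y _ ⟨0, uAgg_zero_mem ω k⟩ (k + 1) (uAgg_card ω k)

lemma factor_le (d k : ℕ) (hd : 1 ≤ d) :
    1 - (2⁻¹ : ℝ≥0∞) * (((k + 1 : ℕ) : ℝ≥0∞)⁻¹ * ((2 * d : ℕ) : ℝ≥0∞)⁻¹) ≤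
      ENNReal.ofReal (Real.exp (-(1 / (4 * d) * ((k : ℝ) + 1)⁻¹))) := by
  have hd' : (0 : ℝ) < d := by exact_mod_cast hd
  have e : (2⁻¹ : ℝ≥0∞) * (((k + 1 : ℕ) : ℝ≥0∞)⁻¹ * ((2 * d : ℕ) : ℝ≥0∞)⁻¹) =
      ENNReal.ofReal (1 / (4 * d) * ((k : ℝ) + 1)⁻¹) := by
    have h1 : (2⁻¹ : ℝ≥0∞) = ENNReal.ofReal (2⁻¹ : ℝ) := by
      rw [ENNReal.ofReal_inv_of_pos (by norm_num)]; simp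
    have h2 : (((k + 1 : ℕ) : ℝ≥0∞)⁻¹) = ENNReal.ofReal (((k + 1 : ℕ) : ℝ)⁻¹) := by
      rw [ENNReal.ofReal_inv_of_pos (by positivity), ENNReal.ofReal_natCast]
    have h3 : (((2 * d : ℕ) : ℝ≥0∞)⁻¹) = ENNReal.ofReal (((2 * d : ℕ) : ℝ)⁻¹) := by
      rw [ENNReal.ofReal_inv_of_pos (by push_cast; positivity), ENNReal.ofReal_natCast]
    rw [h1, h2, h3, ← ENNReal.ofReal_mul (by positivity), ← ENNReal.ofReal_mul (by positivity)]
    congr 1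
    push_cast
    field_simp
    norm_num
  rw [e, ← ENNReal.ofReal_one, ← ENNReal.ofReal_sub _ (by positivity)]
  refine ENNReal.ofReal_le_ofReal ?_
  have := Real.add_one_le_exp (-(1 / (4 * d) * ((k : ℝ) + 1)⁻¹))
  linarith

lemma expect_bound {d : ℕ} (hd : 1 ≤ d) (y : V d) (k : ℕ) :
    ∫⁻ ω, psi y (uAggFrom ({0} : Finset (V d)) ω k) ∂μ0 ≤
      2 ^ (dist1 0 y) * ENNReal.ofReal (Real.exp (-(1 / (4 * d) *
        ∑ i ∈ Finset.range k, ((i : ℝ) + 1)⁻¹))) := by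
  induction k with
  | zero =>
    have : psi y ({0} : Finset (V d)) ≤ 2 ^ (dist1 0 y) := by
      refine (iInf₂_le 0 (Finset.mem_singleton_self _)).trans ?_
      unfold gg; split_ifs <;> simp
    simpa [uAggFrom] using this
  | succ k ih =>
    refine (expect_step y k).trans ((mul_le_mul' (factor_le d k hd) ih).trans (le_of_eq ?_))
    rw [Finset.sum_range_succ, mul_add, neg_add, Real.exp_add, ENNReal.ofReal_mul (Real.exp_pos _).le]
    ring

lemma miss_bound {d : ℕ} (hd : 1 ≤ d) (y : V d) (k : ℕ) :
    μ0 {ω | y ∉ uAggFrom ({0} : Finset (V d)) ω k} ≤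
      2 ^ (dist1 0 y) * ENNReal.ofReal (Real.exp (-(1 / (4 * d) * Real.log (k + 1)))) := by
  have mp : Measurable (psi y) := measurable_of_countable _
  have h1 := mul_meas_ge_le_lintegral (μ := μ0)
    (Measurable.comp (g := psi y) mp (measurable_uAgg ({0} : Finset (V d)) k)) 1
  rw [one_mul] at h1
  have h2 : {ω | y ∉ uAggFrom ({0} : Finset (V d)) ω k} ⊆
      {ω | 1 ≤ (psi y ∘ fun ω => uAggFrom ({0} : Finset (V d)) ω k) ω} := fun ω hω =>
    psi_one_le y _ hω
  refine (measure_mono h2).trans (h1.trans ((expect_bound hd y k).trans ?_))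
  refine mul_le_mul' le_rfl (ENNReal.ofReal_le_ofReal (Real.exp_le_exp.2 (neg_le_neg ?_)))
  refine mul_le_mul_of_nonneg_left ?_ (by positivity)
  have := log_add_one_le_harmonic k
  rw [harmonic] at this
  push_cast at this
  exact this

lemma mem_ball_coord {d : ℕ} {r : ℝ} {y : V d} (hy : y ∈ ball d r) (i : Fin d) :
    (y i).natAbs ≤ ⌈r⌉.toNat := by
  classical
  rw [ball, Finset.mem_filter, Finset.mem_Icc] at hy
  have h1 := hy.1.1 i
  have h2 := hy.1.2 i
  simp only at h1 h2
  omega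

lemma ceil_half_le (n : ℕ) : ⌈(n : ℝ) / 2⌉ ≤ n := by
  rw [Int.ceil_le]
  push_cast
  have : (0 : ℝ) ≤ n := by positivity
  linarith

lemma dist1_ball {d n : ℕ} {y : V d} (hy : y ∈ ball d ((n : ℝ) / 2)) : dist1 0 y ≤ d * n := by
  unfold dist1
  refine (Finset.sum_le_card_nsmul _ _ n fun i _ => ?_).trans (by simp)
  have h1 := mem_ball_coord hy i
  have h2 := ceil_half_le n
  simp only [Pi.zero_apply, zero_sub, Int.natAbs_neg]
  omega

lemma card_ball_le (d n : ℕ) : (ball d ((n : ℝ) / 2)).card ≤ (2 * n + 1) ^ d := by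
  classical
  refine (Finset.card_filter_le _ _).trans ?_
  rw [Pi.card_Icc]
  simp only [Int.card_Icc, Finset.prod_const, Finset.card_univ, Fintype.card_fin]
  refine Nat.pow_le_pow_left ?_ d
  have h2 := ceil_half_le n
  omega

lemma bn_lower (d n : ℕ) (hd : 2 ≤ d) : n ^ 2 ≤ 4 * bn d n := by
  classical
  set m := n / 2 with hm
  let i0 : Fin d := ⟨0, by omega⟩
  let i1 : Fin d := ⟨1, by omega⟩
  have h01 : i0 ≠ i1 := by simp [i0, i1]
  let f : ℕ × ℕ → V d := fun p j => if j = i0 then (p.1 : ℤ) else if j = i1 then (p.2 : ℤ) else 0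
  have hcard : ((Finset.range (m + 1)) ×ˢ (Finset.range (m + 1))).card ≤ (ball d n).card := by
    refine Finset.card_le_card_of_injOn f ?_ ?_
    · rintro ⟨a, b⟩ hab
      simp only [Finset.coe_product, Set.mem_prod, Finset.mem_coe, Finset.mem_range] at hab
      obtain ⟨ha, hb⟩ := hab
      have ha' : a ≤ n := by omega
      have hb' : b ≤ n := by omega
      simp only [Finset.mem_coe, ball, Finset.mem_filter, Finset.mem_Icc, Int.ceil_natCast]
      refine ⟨⟨fun j => ?_, fun j => ?_⟩, ?_⟩
      · simp only [f]; split_ifs <;> omega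
      · simp only [f]; split_ifs <;> omega
      · have hs : ∑ i, ((f (a, b) i : ℤ) : ℝ) ^ 2 = (a : ℝ) ^ 2 + (b : ℝ) ^ 2 := by
          have : ∀ i, ((f (a, b) i : ℤ) : ℝ) ^ 2 =
              (if i = i0 then (a : ℝ) ^ 2 else 0) + (if i = i1 then (b : ℝ) ^ 2 else 0) := by
            intro i
            simp only [f]
            by_cases h0 : i = i0
            · have : i ≠ i1 := by rw [h0]; exact h01
              simp [h0, h01]
            · by_cases h1 : i = i1
              · simp [h1, h01.symm]
              · simp [h0, h1]
          simp_rw [this]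
          rw [Finset.sum_add_distrib]
          simp
        rw [hs, Real.sqrt_le_left (by positivity)]
        have : a ^ 2 + b ^ 2 ≤ n ^ 2 := by
          have h2 : 2 * m ≤ n := by omega
          nlinarith
        exact_mod_cast this
    · rintro ⟨a, b⟩ _ ⟨a', b'⟩ _ h
      have e0 := congrFun h i0
      have e1 := congrFun h i1
      simp [f, h01.symm] at e0 e1
      simp [e0, e1]
  rw [Finset.card_product, Finset.card_range] at hcard
  rw [bn]
  have : n ≤ 2 * m + 1 := by omega
  nlinarith

lemma numeric (d n b : ℕ) (hd : 2 ≤ d) (hn : 100 * d ^ 2 ≤ n) (hb : n ^ 2 ≤ 4 * b) :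
    ((2 * n + 1 : ℕ) : ℝ) ^ d * (2 ^ (d * n) *
      Real.exp (-(1 / (4 * d) * Real.log (((⌊Real.exp b⌋₊ - 1 : ℕ) : ℝ) + 1)))) ≤ Real.exp (-(n : ℝ)) := by
  have hdR : (2 : ℝ) ≤ d := by exact_mod_cast hd
  have hnR : 100 * (d : ℝ) ^ 2 ≤ n := by exact_mod_cast hn
  have hbR : (n : ℝ) ^ 2 ≤ 4 * b := by exact_mod_cast hb
  have hn0 : (400 : ℝ) ≤ n := by nlinarith
  have hb1 : (1 : ℝ) ≤ b := by nlinarith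
  have hE : (1 : ℝ) ≤ Real.exp (b - 1) := Real.one_le_exp (by linarith)
  have hEE : Real.exp b = Real.exp (b - 1) * Real.exp 1 := by rw [← Real.exp_add]; congr 1; ring
  have he : (2 : ℝ) ≤ Real.exp 1 := by have := Real.add_one_le_exp (1 : ℝ); linarith
  have hfl := Nat.lt_floor_add_one (Real.exp b)
  have hF : Real.exp (b - 1) ≤ (⌊Real.exp b⌋₊ : ℝ) := by nlinarith
  have hF1 : 1 ≤ ⌊Real.exp b⌋₊ := by
    have : (1 : ℝ) ≤ (⌊Real.exp b⌋₊ : ℝ) := hE.trans hF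
    exact_mod_cast this
  have hcast : (((⌊Real.exp b⌋₊ - 1 : ℕ) : ℝ) + 1) = (⌊Real.exp b⌋₊ : ℝ) := by
    rw [Nat.cast_sub hF1]; simp
  have hlog : (b : ℝ) - 1 ≤ Real.log (⌊Real.exp b⌋₊ : ℝ) := by
    rw [Real.le_log_iff_exp_le (by linarith)]; exact hF
  rw [hcast]
  have h1 : ((2 * n + 1 : ℕ) : ℝ) ^ d ≤ Real.exp (d * (2 * n)) := by
    rw [Real.exp_nat_mul]
    refine pow_le_pow_left₀ (by positivity) ?_ d
    push_cast; exact Real.add_one_le_exp _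
  have h2 : (2 : ℝ) ^ (d * n) ≤ Real.exp (((d * n : ℕ) : ℝ) * 1) := by
    rw [Real.exp_nat_mul]
    exact pow_le_pow_left₀ (by norm_num) he _
  have h3 : Real.exp (-(1 / (4 * d) * Real.log (⌊Real.exp b⌋₊ : ℝ))) ≤
      Real.exp (-(1 / (4 * d) * ((b : ℝ) - 1))) := by
    refine Real.exp_le_exp.2 (neg_le_neg (mul_le_mul_of_nonneg_left hlog (by positivity)))
  refine (mul_le_mul h1 (mul_le_mul h2 h3 (Real.exp_pos _).le (Real.exp_pos _).le)
    (by positivity) (Real.exp_pos _).le).trans ?_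
  rw [← Real.exp_add, ← Real.exp_add]
  refine Real.exp_le_exp.2 ?_
  have key : (3 * d + 1) * (n : ℝ) ≤ 1 / (4 * d) * ((b : ℝ) - 1) := by
    rw [one_div, ← div_eq_inv_mul, le_div_iff₀ (by positivity)]
    nlinarith [mul_le_mul_of_nonneg_right hnR (by linarith : (0 : ℝ) ≤ n)]
  push_cast
  linarith

end Prob

theorem statement15 (d : ℕ) (hd : 2 ≤ d) :
    ∃ δ₆ : ℝ, 0 < δ₆ ∧ ∃ N : ℕ, ∀ n : ℕ, N ≤ n →
      1 - ENNReal.ofReal (Real.exp (-(n : ℝ) ^ δ₆)) ≤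
        μ0 {ω | ball d ((n : ℝ) / 2) ⊆
          uAggFrom ({0} : Finset (V d)) ω (⌊Real.exp (bn d n)⌋₊ - 1)} := by
  refine ⟨1, one_pos, 100 * d ^ 2, fun n hn => ?_⟩
  set K := ⌊Real.exp (bn d n)⌋₊ - 1 with hK
  set E := {ω | ball d ((n : ℝ) / 2) ⊆ uAggFrom ({0} : Finset (V d)) ω K} with hE
  have hcompl : μ0 Eᶜ ≤ ENNReal.ofReal (Real.exp (-(n : ℝ))) := by
    have hsub : Eᶜ ⊆ ⋃ y ∈ ball d ((n : ℝ) / 2),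
        {ω | y ∉ uAggFrom ({0} : Finset (V d)) ω K} := by
      intro ω hω
      have h : ¬ (ball d ((n : ℝ) / 2) ⊆ uAggFrom ({0} : Finset (V d)) ω K) := hω
      obtain ⟨y, hy, hy'⟩ := Finset.not_subset.1 h
      exact Set.mem_biUnion hy hy'
    refine (measure_mono hsub).trans ((measure_biUnion_finset_le _ _).trans ?_)
    refine (Finset.sum_le_card_nsmul _ _ (2 ^ (d * n) *
      ENNReal.ofReal (Real.exp (-(1 / (4 * d) * Real.log ((K : ℝ) + 1))))) fun y hy => ?_).trans ?_
    · refine (miss_bound (by omega) y K).trans (mul_le_mul' ?_ le_rfl)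
      exact pow_le_pow_right₀ (by norm_num) (dist1_ball hy)
    · rw [nsmul_eq_mul]
      refine (mul_le_mul' (Nat.cast_le.2 (card_ball_le d n)) le_rfl).trans ?_
      refine le_trans (le_of_eq ?_)
        (ENNReal.ofReal_le_ofReal (numeric d n (bn d n) hd hn (bn_lower d n hd)))
      rw [ENNReal.ofReal_mul (by positivity), ENNReal.ofReal_mul (by positivity),
        ENNReal.ofReal_pow (by positivity), ENNReal.ofReal_pow (by norm_num),
        ENNReal.ofReal_natCast, ENNReal.ofReal_ofNat, Nat.cast_pow]
  rw [Real.rpow_one]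
  have h1 : (1 : ℝ≥0∞) ≤ μ0 E + μ0 Eᶜ := by
    rw [← measure_univ (μ := μ0), ← Set.union_compl_self E]
    exact measure_union_le _ _
  exact tsub_le_iff_right.2 (h1.trans (add_le_add le_rfl hcompl))
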